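/- arXiv:1901.04813 — 2 statements merged into one kernel-verified Lean document; each statement's English description precedes it below -/
import Mathlib

section
/- Let Y and X be locally compact Hausdorff spaces and let φ : Y → X be a surjective continuous map such that the preimage of every compact set is compact. Let X̃ be a compact Hausdorff space and i : X → X̃ a topological embedding with dense image, and let Φ : βY → X̃ be a continuous map with Φ ∘ η = i ∘ φ, where η : Y → βY is the canonical map into the Stone–Čech compactification. Then for every z ∈ βY, one has Φ(z) ∈ i(X) if and only if z ∈ η(Y). Consequently Φ maps η(Y) onto i(X) and maps βY \ η(Y) onto X̃ \ i(X). -/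
/-- Let `φ : Y → X` be a proper continuous surjection between locally compact Hausdorff
spaces, `i : X → X'` a compactification of `X`, and `Φ : βY → X'` a continuous map with
`Φ ∘ η = i ∘ φ`.  Then `Φ z ∈ i(X)` iff `z ∈ η(Y)`; consequently `Φ` maps `η(Y)` onto
`i(X)` and `βY \ η(Y)` onto `X' \ i(X)`. -/
theorem stmt8 {Y X X' : Type*} [TopologicalSpace Y] [TopologicalSpace X]
    [TopologicalSpace X'] [LocallyCompactSpace Y] [T2Space Y]
    [LocallyCompactSpace X] [T2Space X] [CompactSpace X'] [T2Space X']
    (φ : Y → X) (hφc : Continuous φ) (hφs : Function.Surjective φ)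
    (hproper : ∀ K : Set X, IsCompact K → IsCompact (φ ⁻¹' K))
    (i : X → X') (hi : Topology.IsEmbedding i) (hdense : DenseRange i)
    (Φ : StoneCech Y → X') (hΦc : Continuous Φ) (hΦ : Φ ∘ stoneCechUnit = i ∘ φ) :
    (∀ z : StoneCech Y, Φ z ∈ Set.range i ↔ z ∈ Set.range (stoneCechUnit : Y → StoneCech Y)) ∧
    Φ '' Set.range (stoneCechUnit : Y → StoneCech Y) = Set.range i ∧
    Φ '' (Set.range (stoneCechUnit : Y → StoneCech Y))ᶜ = (Set.range i)ᶜ := by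
  have hpt : ∀ y, Φ (stoneCechUnit y) = i (φ y) := fun y => congrFun hΦ y
  have key : ∀ z : StoneCech Y,
      Φ z ∈ Set.range i ↔ z ∈ Set.range (stoneCechUnit : Y → StoneCech Y) := by
    intro z
    constructor
    · rintro ⟨x, hx⟩
      obtain ⟨K, hK, hxK⟩ := exists_compact_mem_nhds x
      rw [hi.isInducing.nhds_eq_comap, Filter.mem_comap] at hxK
      obtain ⟨U, hU, hUK⟩ := hxK
      rw [hx] at hU
      have hV : Φ ⁻¹' U ∈ nhds z := hΦc.continuousAt hU
      have hC : IsCompact ((stoneCechUnit : Y → StoneCech Y) '' (φ ⁻¹' K)) :=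
        (hproper K hK).image continuous_stoneCechUnit
      have hz : z ∈ closure ((stoneCechUnit : Y → StoneCech Y) '' (φ ⁻¹' K)) := by
        rw [mem_closure_iff_nhds]
        intro W hW
        obtain ⟨y, hy⟩ := denseRange_stoneCechUnit.mem_nhds (Filter.inter_mem hW hV)
        refine ⟨stoneCechUnit y, hy.1, y, hUK ?_, rfl⟩
        have h2 : Φ (stoneCechUnit y) ∈ U := hy.2
        rw [hpt] at h2
        exact h2
      rw [hC.isClosed.closure_eq] at hz
      exact Set.image_subset_range _ _ hz
    · rintro ⟨y, rfl⟩
      exact ⟨φ y, (hpt y).symm⟩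
  have hsurj : Function.Surjective Φ := by
    have hcl : IsClosed (Set.range Φ) := (isCompact_range hΦc).isClosed
    have hsub : Set.range i ⊆ Set.range Φ := by
      rintro _ ⟨x, rfl⟩
      obtain ⟨y, rfl⟩ := hφs x
      exact ⟨_, hpt y⟩
    intro w
    exact hcl.closure_subset_iff.2 hsub (hdense w)
  have hpre : Set.range (stoneCechUnit : Y → StoneCech Y) = Φ ⁻¹' Set.range i := by
    ext z
    exact (key z).symm
  refine ⟨key, ?_, ?_⟩
  · rw [hpre, Set.image_preimage_eq _ hsurj]
  · rw [hpre, ← Set.preimage_compl, Set.image_preimage_eq _ hsurj]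
end

section
/- Let G be a group, N a normal subgroup of G, and t ∈ G an element whose centralizer in G is exactly the cyclic subgroup ⟨t⟩ generated by t. For s, s' ∈ G, the N-conjugacy classes of s t s⁻¹ and of s' t s'⁻¹ coincide, i.e. {g (s t s⁻¹) g⁻¹ : g ∈ N} = {g (s' t s'⁻¹) g⁻¹ : g ∈ N}, if and only if s⁻¹ s' belongs to the subgroup ⟨t⟩N = {t^k n : k ∈ ℤ, n ∈ N}. -/
/-- Let `G` be a group, `N` a normal subgroup, and `t ∈ G` with centralizer exactly
`⟨t⟩`.  For `s, s' ∈ G`, the `N`-conjugacy classes of `s t s⁻¹` and `s' t s'⁻¹` coincide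
iff `s⁻¹ s' ∈ ⟨t⟩N`. -/
theorem stmt13 {G : Type*} [Group G] (N : Subgroup G) (hN : N.Normal) (t : G)
    (hcent : Subgroup.centralizer {t} = Subgroup.zpowers t) (s s' : G) :
    {x : G | ∃ g ∈ N, x = g * (s * t * s⁻¹) * g⁻¹} =
      {x : G | ∃ g ∈ N, x = g * (s' * t * s'⁻¹) * g⁻¹} ↔
    ∃ (k : ℤ) (n : G), n ∈ N ∧ s⁻¹ * s' = t ^ k * n := by
  constructor
  · intro h
    have h1 : s * t * s⁻¹ ∈ {x : G | ∃ g ∈ N, x = g * (s * t * s⁻¹) * g⁻¹} :=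
      ⟨1, N.one_mem, by group⟩
    rw [h] at h1
    obtain ⟨g, hg, e⟩ := h1
    have hc : s⁻¹ * g * s' ∈ Subgroup.centralizer {t} := by
      rw [Subgroup.mem_centralizer_singleton_iff]
      have e2 : t = s⁻¹ * (g * (s' * t * s'⁻¹) * g⁻¹) * s := by
        rw [← e]; group
      calc s⁻¹ * g * s' * t
          = s⁻¹ * (g * (s' * t * s'⁻¹) * g⁻¹) * s * (s⁻¹ * g * s') := by group
        _ = t * (s⁻¹ * g * s') := by rw [← e2]
    rw [hcent, Subgroup.mem_zpowers_iff] at hc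
    obtain ⟨k, hk⟩ := hc
    refine ⟨k, ((t ^ k)⁻¹ * s⁻¹) * g⁻¹ * ((t ^ k)⁻¹ * s⁻¹)⁻¹,
      hN.conj_mem _ (N.inv_mem hg) _, ?_⟩
    rw [hk]; group
  · rintro ⟨k, n, hn, e⟩
    have hs' : s' = s * t ^ k * n := by
      rw [mul_assoc, ← e]; group
    obtain ⟨m, hm, e2⟩ : ∃ m ∈ N, s' = m * (s * t ^ k) :=
      ⟨_, hN.conj_mem n hn (s * t ^ k), by rw [hs']; group⟩
    have key : s' * t * s'⁻¹ = m * (s * t * s⁻¹) * m⁻¹ := by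
      rw [e2]; group
    ext x
    simp only [Set.mem_setOf_eq, key]
    constructor
    · rintro ⟨g, hg, rfl⟩
      exact ⟨g * m⁻¹, N.mul_mem hg (N.inv_mem hm), by group⟩
    · rintro ⟨g, hg, rfl⟩
      exact ⟨g * m, N.mul_mem hg hm, by group⟩
end
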